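/- Completeness of the tableau procedure: if the tableau T_{φ0} is not closed (i.e. some complete subtree of T_{φ0} contains no node with a blatantly inconsistent label), then the formula φ0 is satisfiable in some ELKh_n model. -/

import Mathlib

/-!
Formalization of the logic of strategically knowing how (ELKh_n) and of the
tableau procedure for it.
-/

namespace ELKh

/-- Formulas of the language ELKh_n:
`φ ::= ⊥ | p | ¬φ | (φ ∧ φ) | K_i φ | Kh_i φ`. -/
inductive Formula (P I : Type) : Type
  | bot : Formula P I
  | atom : P → Formula P I
  | neg : Formula P I → Formula P I
  | and : Formula P I → Formula P I → Formula P I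
  | know : I → Formula P I → Formula P I
  | kh : I → Formula P I → Formula P I

variable {P I : Type}

/-- Models of ELKh_n: states with equivalence relations `∼ᵢ`, actions for each
agent, a transition relation for each action, and a valuation. -/
structure Model (P I : Type) where
  W : Type
  sim : I → W → W → Prop
  equiv : ∀ i, Equivalence (sim i)
  Act : I → Type
  R : (i : I) → Act i → W → W → Prop
  V : W → P → Prop

/-- Transition between `i`-equivalence classes (classes are represented by
member states): `[s]ⁱ →ₐ [t]ⁱ` iff some `s' ∈ [s]ⁱ`, `t' ∈ [t]ⁱ` have `R a s' t'`. -/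
def Model.ctrans (M : Model P I) (i : I) (a : M.Act i) (s t : M.W) : Prop :=
  ∃ s' t', M.sim i s s' ∧ M.sim i t t' ∧ M.R i a s' t'

/-- Uniformly executable strategies for agent `i`: partial functions from
`∼ᵢ`-equivalence classes to actions of `i` (hence constant on classes), whose
chosen action is executable at every member of the class. -/
structure Strategy (M : Model P I) (i : I) where
  act : M.W → Option (M.Act i)
  congr : ∀ s t, M.sim i s t → act s = act t
  exec : ∀ s a, act s = some a → ∀ t, M.sim i s t → ∃ u, M.R i a t u

namespace Strategy

variable {M : Model P I} {i : I}

/-- The `k`-th step of the sequence of classes `[δ 0][δ 1]⋯` is a σ-step. -/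
def Steps (σ : Strategy M i) (δ : ℕ → M.W) (k : ℕ) : Prop :=
  ∃ a, σ.act (δ k) = some a ∧ M.ctrans i a (δ k) (δ (k+1))

/-- `[δ 0]⋯[δ h]` is a (finite) possible execution of σ. -/
def FinExec (σ : Strategy M i) (δ : ℕ → M.W) (h : ℕ) : Prop :=
  ∀ k < h, σ.Steps δ k

/-- `[δ 0]⋯[δ h]` is a complete finite execution of σ (its end class is not in
the domain of σ). -/
def CompleteFinExec (σ : Strategy M i) (δ : ℕ → M.W) (h : ℕ) : Prop :=
  σ.FinExec δ h ∧ σ.act (δ h) = none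

/-- `[δ 0][δ 1]⋯` is an infinite possible execution of σ (such an execution is
automatically complete). -/
def InfExec (σ : Strategy M i) (δ : ℕ → M.W) : Prop :=
  ∀ k, σ.Steps δ k

end Strategy

/-- Satisfaction for ELKh_n.  `Kh_i φ` holds at `s` iff there is a strategy σ
for `i` such that all complete executions of σ starting from `[s]ⁱ` are finite
(equivalently: there is no infinite execution of σ from `[s]ⁱ`) and every state
of every end class of a complete (finite) execution from `[s]ⁱ` satisfies `φ`. -/
def Sat (M : Model P I) : M.W → Formula P I → Prop
  | _, .bot => False
  | s, .atom p => M.V s p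
  | s, .neg φ => ¬ Sat M s φ
  | s, .and φ ψ => Sat M s φ ∧ Sat M s ψ
  | s, .know i φ => ∀ t, M.sim i s t → Sat M t φ
  | s, .kh i φ => ∃ σ : Strategy M i,
      (∀ δ : ℕ → M.W, M.sim i s (δ 0) → ¬ σ.InfExec δ) ∧
      (∀ (δ : ℕ → M.W) (h : ℕ), M.sim i s (δ 0) → σ.CompleteFinExec δ h →
        ∀ t, M.sim i (δ h) t → Sat M t φ)

/-! ### Subformulas -/

/-- The set of subformulas of a formula. -/
def subf : Formula P I → Set (Formula P I)
  | .bot => {Formula.bot}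
  | .atom p => {Formula.atom p}
  | .neg φ => insert (Formula.neg φ) (subf φ)
  | .and φ ψ => insert (Formula.and φ ψ) (subf φ ∪ subf ψ)
  | .know i φ => insert (Formula.know i φ) (subf φ)
  | .kh i φ => insert (Formula.kh i φ) (subf φ)

/-- `sub⁺(φ₀) = {ψ, ¬ψ : ψ subformula of φ₀} ∪ {Kᵢψ, ¬Kᵢψ : Khᵢψ subformula of φ₀}`. -/
def subPlus (φ0 : Formula P I) : Set (Formula P I) :=
  {χ | ∃ ψ ∈ subf φ0, χ = ψ ∨ χ = Formula.neg ψ} ∪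
  {χ | ∃ i ψ, Formula.kh i ψ ∈ subf φ0 ∧
      (χ = Formula.know i ψ ∨ χ = Formula.neg (Formula.know i ψ))}

/-- `∼ψ`:  `∼¬χ = χ`, and `∼ψ = ¬ψ` otherwise. -/
def simNeg : Formula P I → Formula P I
  | .neg χ => χ
  | ψ => Formula.neg ψ

/-! ### Labeled trees -/

/-- Labels of tableau edges: `ε`, an agent `i`, or an action `a_{Khᵢψ}`. -/
inductive ELabel (P I : Type) : Type
  | eps : ELabel P I
  | ag : I → ELabel P I
  | act : I → Formula P I → ELabel P I

/-- Labeled rooted trees: each node is labeled with a set of formulas, each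
non-root node carries the label of the edge connecting it to its parent, and
`blockedBy n = some n'` records that the node `n` is blocked by `n'`. -/
structure LTree (P I : Type) where
  Node : Type
  root : Node
  parent : Node → Option Node
  depth : Node → ℕ
  label : Node → Set (Formula P I)
  elabel : Node → ELabel P I
  blockedBy : Node → Option Node
  parent_root : parent root = none
  eq_root : ∀ n, parent n = none → n = root
  depth_root : depth root = 0
  depth_parent : ∀ n m, parent n = some m → depth n = depth m + 1

variable (T : LTree P I)

/-- The children of a node. -/
def Children (n : T.Node) : Set T.Node := {m | T.parent m = some n}

/-- A node is a leaf iff it has no children. -/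
def IsLeaf (n : T.Node) : Prop := ∀ m, T.parent m ≠ some n

/-- `Ancestor T m n`: `m` is a proper ancestor of `n`. -/
def Ancestor (m n : T.Node) : Prop :=
  Relation.TransGen (fun a b => T.parent b = some a) m n

/-- `IAnc T i m n`: `m` is an `i`-ancestor of `n`, i.e. a proper ancestor of
`n` connected to `n` by a path all of whose edges are labeled `i` or `ε`. -/
inductive IAnc (i : I) : T.Node → T.Node → Prop
  | single {m n} : T.parent n = some m →
      (T.elabel n = ELabel.eps ∨ T.elabel n = ELabel.ag i) → IAnc i m n
  | cons {m k n} : T.parent n = some k →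
      (T.elabel n = ELabel.eps ∨ T.elabel n = ELabel.ag i) →
      IAnc i m k → IAnc i m n

/-! ### The tableau construction -/

/-- A set of formulas is blatantly inconsistent iff it contains `⊥` or some
pair `ψ, ¬ψ`. -/
def Blatant (Γ : Set (Formula P I)) : Prop :=
  Formula.bot ∈ Γ ∨ ∃ ψ, ψ ∈ Γ ∧ Formula.neg ψ ∈ Γ

/-- `AutoChecked Γ φ` holds iff none of the expansion rules (a)-(g) is
applicable to `φ` in the label `Γ`; such formulas are (and remain) marked
``checked'' by step (h) of the construction. -/
def AutoChecked (Γ : Set (Formula P I)) : Formula P I → Prop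
  | .neg (.neg ψ) => ψ ∈ Γ
  | .and ψ χ => ψ ∈ Γ ∧ χ ∈ Γ
  | .neg (.and ψ χ) =>
      (Formula.neg ψ ∈ Γ ∧ Formula.neg χ ∈ Γ) ∨
      (Formula.neg ψ ∈ Γ ∧ χ ∈ Γ) ∨ (ψ ∈ Γ ∧ Formula.neg χ ∈ Γ)
  | .know _ ψ => ψ ∈ Γ
  | .neg (.know _ ψ) => Formula.neg ψ ∈ Γ ∨ ψ ∈ Γ
  | .kh i ψ => Formula.neg (Formula.know i ψ) ∈ Γ ∨ Formula.know i ψ ∈ Γ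
  | .neg (.kh i ψ) => Formula.neg (Formula.know i ψ) ∈ Γ
  | _ => True

/-- All formulas of `Γ` are checked; nodes with such labels are the ``and''
nodes (expanded by step (2)), the remaining expanded nodes are ``or'' nodes. -/
def Saturated (Γ : Set (Formula P I)) : Prop := ∀ φ ∈ Γ, AutoChecked Γ φ

/-- The labels of the children created when one of the rules (a)-(g) processes
the formula `φ` at a node labeled `Γ`. -/
def orOut (Γ : Set (Formula P I)) : Formula P I → Set (Set (Formula P I))
  | .neg (.neg ψ) => {insert ψ Γ}
  | .and ψ χ => {insert ψ (insert χ Γ)}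
  | .neg (.and ψ χ) =>
      {insert (Formula.neg ψ) (insert (Formula.neg χ) Γ),
       insert (Formula.neg ψ) (insert χ Γ),
       insert ψ (insert (Formula.neg χ) Γ)}
  | .know _ ψ => {insert ψ Γ}
  | .neg (.know _ ψ) => {insert (Formula.neg ψ) Γ, insert ψ Γ}
  | .kh i ψ =>
      {insert (Formula.neg (Formula.know i ψ)) Γ, insert (Formula.know i ψ) Γ}
  | .neg (.kh i ψ) => {insert (Formula.neg (Formula.know i ψ)) Γ}
  | _ => ∅

/-- `Σ(n,¬Kᵢψ) = {¬ψ} ∪ Γ|Kᵢ ∪ Γ|¬Kᵢ ∪ Γ|Khᵢ ∪ Γ|¬Khᵢ` where `Γ = L(n)`. -/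
def SigmaSet (Γ : Set (Formula P I)) (i : I) (ψ : Formula P I) :
    Set (Formula P I) :=
  insert (Formula.neg ψ)
    {φ ∈ Γ | (∃ χ, φ = Formula.know i χ) ∨ (∃ χ, φ = Formula.neg (Formula.know i χ)) ∨
             (∃ χ, φ = Formula.kh i χ) ∨ (∃ χ, φ = Formula.neg (Formula.kh i χ))}

/-- Expansion condition for ``or'' nodes (step (1), rules (a)-(g)): some
unchecked formula of the label is processed and the children of the node are
exactly the prescribed `ε`-children. -/
def OrNodeCond (n : T.Node) : Prop :=
  ∃ φ ∈ T.label n, ¬ AutoChecked (T.label n) φ ∧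
    (∀ Δ ∈ orOut (T.label n) φ,
      ∃ m, T.parent m = some n ∧ T.elabel m = ELabel.eps ∧ T.label m = Δ ∧
        T.blockedBy m = none) ∧
    (∀ m, T.parent m = some n →
      T.elabel m = ELabel.eps ∧ T.label m ∈ orOut (T.label n) φ ∧
        T.blockedBy m = none)

/-- Expansion condition for ``and'' nodes (step (2), rules (i), (j), (k)): the
children of the node are exactly those prescribed by the three rules, and a
(k)-child is blocked iff some ancestor carries the same label. -/
def AndNodeCond (n : T.Node) : Prop :=
  (∀ i ψ, Formula.neg (Formula.know i ψ) ∈ T.label n →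
    ¬ (∃ n', IAnc T i n' n ∧ T.label n' = SigmaSet (T.label n) i ψ) →
    ∃ m, T.parent m = some n ∧ T.elabel m = ELabel.ag i ∧
      T.label m = SigmaSet (T.label n) i ψ ∧ T.blockedBy m = none) ∧
  (∀ i ψ, Formula.kh i ψ ∈ T.label n → Formula.neg (Formula.know i ψ) ∈ T.label n →
    ∃ m, T.parent m = some n ∧ T.elabel m = ELabel.act i ψ ∧
      T.label m = {Formula.know i ψ} ∧ T.blockedBy m = none) ∧
  (∀ i ψ χ, Formula.neg (Formula.kh i χ) ∈ T.label n →
    Formula.kh i ψ ∈ T.label n → Formula.neg (Formula.know i ψ) ∈ T.label n →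
    ∃ m, T.parent m = some n ∧ T.elabel m = ELabel.act i ψ ∧
      T.label m = {Formula.know i ψ, Formula.neg (Formula.kh i χ)} ∧
      ((∃ n', Ancestor T n' m ∧ T.label n' = T.label m) ↔ T.blockedBy m ≠ none)) ∧
  (∀ m, T.parent m = some n →
    (∃ i ψ, T.elabel m = ELabel.ag i ∧ Formula.neg (Formula.know i ψ) ∈ T.label n ∧
      T.label m = SigmaSet (T.label n) i ψ ∧
      ¬ (∃ n', IAnc T i n' n ∧ T.label n' = SigmaSet (T.label n) i ψ)) ∨
    (∃ i ψ, T.elabel m = ELabel.act i ψ ∧ Formula.kh i ψ ∈ T.label n ∧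
      Formula.neg (Formula.know i ψ) ∈ T.label n ∧
      T.label m = {Formula.know i ψ}) ∨
    (∃ i ψ χ, T.elabel m = ELabel.act i ψ ∧ Formula.neg (Formula.kh i χ) ∈ T.label n ∧
      Formula.kh i ψ ∈ T.label n ∧ Formula.neg (Formula.know i ψ) ∈ T.label n ∧
      T.label m = {Formula.know i ψ, Formula.neg (Formula.kh i χ)}))

/-- `T` is a tableau for `φ₀`: the root is labeled `{φ₀}`, blocked nodes are
blocked by an ancestor with the same label, blocked nodes and blatantly
inconsistent nodes are leaves, and every other node is expanded according to
step (1) (``or'' nodes) or step (2) (``and'' nodes) of the construction. -/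
structure IsTableau (φ0 : Formula P I) (T : LTree P I) : Prop where
  root_label : T.label T.root = {φ0}
  blocked_spec : ∀ n n', T.blockedBy n = some n' →
    Ancestor T n' n ∧ T.label n' = T.label n
  blocked_leaf : ∀ n, T.blockedBy n ≠ none → IsLeaf T n
  blatant_leaf : ∀ n, Blatant (T.label n) → IsLeaf T n
  or_node : ∀ n, ¬ Blatant (T.label n) → T.blockedBy n = none →
    ¬ Saturated (T.label n) → OrNodeCond T n
  and_node : ∀ n, ¬ Blatant (T.label n) → T.blockedBy n = none →
    Saturated (T.label n) → AndNodeCond T n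

/-! ### Subtrees -/

/-- A subtree: a set of nodes containing the root and closed under parents. -/
def IsSubtree (S : Set T.Node) : Prop :=
  T.root ∈ S ∧ ∀ n ∈ S, ∀ m, T.parent n = some m → m ∈ S

/-- A complete subtree: it contains the root, all children of each of its
``and'' non-leaf nodes, and at least one child of each of its ``or'' non-leaf
nodes. -/
def CompleteSubtree (S : Set T.Node) : Prop :=
  IsSubtree T S ∧
  (∀ n ∈ S, ¬ IsLeaf T n → Saturated (T.label n) → ∀ m ∈ Children T n, m ∈ S) ∧
  (∀ n ∈ S, ¬ IsLeaf T n → ¬ Saturated (T.label n) → ∃ m ∈ Children T n, m ∈ S)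

/-- A subtree is closed iff some of its nodes has a blatantly inconsistent
label; otherwise it is open. -/
def ClosedSubtree (S : Set T.Node) : Prop := ∃ n ∈ S, Blatant (T.label n)

/-- A tableau is closed iff all its complete subtrees are closed. -/
def TableauClosed : Prop := ∀ S : Set T.Node, CompleteSubtree T S → ClosedSubtree T S

/-! ### Maximal ε-paths and the induced model -/

/-- An `ε`-edge from `m` down to `n` inside the node set `S`. -/
def EpsStep (S : Set T.Node) (m n : T.Node) : Prop :=
  m ∈ S ∧ n ∈ S ∧ T.parent n = some m ∧ T.elabel n = ELabel.eps

/-- `n` is an `ε`-descendant of `m` inside `S` (reflexive-transitive). -/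
def EpsDesc (S : Set T.Node) : T.Node → T.Node → Prop :=
  Relation.ReflTransGen (EpsStep T S)

/-- A maximal `ε`-path of the subtree with node set `S`, recorded by its
initial node `top` and its end node `bot`.  Its label is `T.label bot`. -/
structure MaxEpsPath (T : LTree P I) (S : Set T.Node) where
  top : T.Node
  bot : T.Node
  top_mem : top ∈ S
  bot_mem : bot ∈ S
  desc : EpsDesc T S top bot
  top_max : ∀ m, ¬ EpsStep T S m top
  bot_max : ∀ m, ¬ EpsStep T S bot m

/-- The states of the induced model: non-blocked maximal `ε`-paths. -/
def PathW (T : LTree P I) (S : Set T.Node) : Type :=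
  {ρ : MaxEpsPath T S // T.blockedBy ρ.bot = none}

/-- `ρ₂` is an `i`-child path of `ρ₁`: `ρ₁ρ₂` is a path whose connecting edge
is labeled `i`. -/
def ISimStep (S : Set T.Node) (i : I) (ρ1 ρ2 : PathW T S) : Prop :=
  T.parent ρ2.1.top = some ρ1.1.bot ∧ T.elabel ρ2.1.top = ELabel.ag i

/-- The node `n'` lies on the maximal `ε`-path `ρ`. -/
def OnPath (S : Set T.Node) (ρ : MaxEpsPath T S) (n' : T.Node) : Prop :=
  EpsDesc T S ρ.top n' ∧ EpsDesc T S n' ρ.bot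

/-- The model `M^T` induced by the (complete) subtree with node set `S`:
states are the non-blocked maximal `ε`-paths, `∼ᵢ` is the least equivalence
relation containing the `i`-edge steps, actions of agent `i` are the actions
`a_{Khᵢψ}` labeling edges of the subtree, `(ρ, ρ') ∈ R_a` iff there is an
`a`-edge from the end of `ρ` to the start of a maximal `ε`-path `ρ''` where
`ρ'' = ρ'` or `ρ''` is blocked by a node lying on `ρ'`, and `ρ ∈ V(p)` iff
`p ∈ L(ρ)`. -/
def inducedModel (T : LTree P I) (S : Set T.Node) : Model P I where
  W := PathW T S
  sim := fun i => Relation.EqvGen (ISimStep T S i)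
  equiv := fun _ => Relation.EqvGen.is_equivalence _
  Act := fun i => {ψ : Formula P I // ∃ m n, m ∈ S ∧ n ∈ S ∧
    T.parent m = some n ∧ T.elabel m = ELabel.act i ψ}
  R := fun i a ρ1 ρ2 => ∃ ρ'' : MaxEpsPath T S,
    T.parent ρ''.top = some ρ1.1.bot ∧ T.elabel ρ''.top = ELabel.act i a.1 ∧
    (ρ'' = ρ2.1 ∨ ∃ n', T.blockedBy ρ''.bot = some n' ∧ OnPath T S ρ2.1 n')
  V := fun ρ p => Formula.atom p ∈ T.label ρ.1.bot

/-- `L(ρ)|Kᵢ`: the `Kᵢ`-formulas of `Γ`. -/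
def projK (i : I) (Γ : Set (Formula P I)) : Set (Formula P I) :=
  {φ ∈ Γ | ∃ ψ, φ = Formula.know i ψ}

/-- `L(ρ)|¬Kᵢ`: the `¬Kᵢ`-formulas of `Γ`. -/
def projNK (i : I) (Γ : Set (Formula P I)) : Set (Formula P I) :=
  {φ ∈ Γ | ∃ ψ, φ = Formula.neg (Formula.know i ψ)}

/-- `L(ρ)|Khᵢ`: the `Khᵢ`-formulas of `Γ`. -/
def projKh (i : I) (Γ : Set (Formula P I)) : Set (Formula P I) :=
  {φ ∈ Γ | ∃ ψ, φ = Formula.kh i ψ}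

/-- `L(ρ)|¬Khᵢ`: the `¬Khᵢ`-formulas of `Γ`. -/
def projNKh (i : I) (Γ : Set (Formula P I)) : Set (Formula P I) :=
  {φ ∈ Γ | ∃ ψ, φ = Formula.neg (Formula.kh i ψ)}

/-! ### Closure of labels under the expansion rules -/

/-- `D` contains every formula that the expansion rules can derive from members of `D`. -/
structure RuleClosed (D : Set (Formula P I)) : Prop where
  neg_neg : ∀ ψ, Formula.neg (.neg ψ) ∈ D → ψ ∈ D
  and : ∀ ψ χ, Formula.and ψ χ ∈ D → ψ ∈ D ∧ χ ∈ D
  neg_and : ∀ ψ χ, Formula.neg (.and ψ χ) ∈ D →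
    (ψ ∈ D ∧ Formula.neg ψ ∈ D) ∧ χ ∈ D ∧ Formula.neg χ ∈ D
  know : ∀ i ψ, Formula.know i ψ ∈ D → ψ ∈ D
  neg_know : ∀ i ψ, Formula.neg (.know i ψ) ∈ D → ψ ∈ D ∧ Formula.neg ψ ∈ D
  kh : ∀ i ψ, Formula.kh i ψ ∈ D → Formula.know i ψ ∈ D ∧ Formula.neg (.know i ψ) ∈ D
  neg_kh : ∀ i ψ, Formula.neg (.kh i ψ) ∈ D → Formula.neg (.know i ψ) ∈ D

theorem RuleClosed.orOut_subset {D Γ Δ : Set (Formula P I)} {φ : Formula P I}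
    (hD : RuleClosed D) (hΓ : Γ ⊆ D) (hφ : φ ∈ Γ) (hΔ : Δ ∈ orOut Γ φ) : Δ ⊆ D := by
  have hφD := hΓ hφ
  rcases φ with _ | _ | (_ | _ | ψ | ⟨ψ, χ⟩ | ⟨i, ψ⟩ | ⟨i, ψ⟩) | ⟨ψ, χ⟩ | ⟨i, ψ⟩ | ⟨i, ψ⟩ <;>
    simp only [orOut, Set.mem_empty_iff_false, Set.mem_singleton_iff, Set.mem_insert_iff] at hΔ
  · subst hΔ
    exact Set.insert_subset (hD.neg_neg _ hφD) hΓ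
  · obtain ⟨⟨h1, h2⟩, h3, h4⟩ := hD.neg_and _ _ hφD
    rcases hΔ with rfl | rfl | rfl <;>
      exact Set.insert_subset ‹_› (Set.insert_subset ‹_› hΓ)
  · obtain ⟨h1, h2⟩ := hD.neg_know _ _ hφD
    rcases hΔ with rfl | rfl <;> exact Set.insert_subset ‹_› hΓ
  · subst hΔ
    exact Set.insert_subset (hD.neg_kh _ _ hφD) hΓ
  · subst hΔ
    obtain ⟨h1, h2⟩ := hD.and _ _ hφD
    exact Set.insert_subset h1 (Set.insert_subset h2 hΓ)
  · subst hΔ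
    exact Set.insert_subset (hD.know _ _ hφD) hΓ
  · obtain ⟨h1, h2⟩ := hD.kh _ _ hφD
    rcases hΔ with rfl | rfl <;> exact Set.insert_subset ‹_› hΓ

theorem ssubset_of_mem_orOut {Γ Δ : Set (Formula P I)} {φ : Formula P I}
    (hφ : ¬ AutoChecked Γ φ) (hΔ : Δ ∈ orOut Γ φ) : Γ ⊂ Δ := by
  have key : Γ ⊆ Δ ∧ Δ ≠ Γ := by
    rcases φ with _ | _ | (_ | _ | ψ | ⟨ψ, χ⟩ | ⟨i, ψ⟩ | ⟨i, ψ⟩) | ⟨ψ, χ⟩ | ⟨i, ψ⟩ | ⟨i, ψ⟩ <;>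
      simp only [orOut, Set.mem_empty_iff_false, Set.mem_singleton_iff,
        Set.mem_insert_iff] at hΔ <;>
      simp only [AutoChecked] at hφ <;>
      refine ⟨by grind, fun h => hφ ?_⟩ <;> grind
  exact key.1.ssubset_of_ne key.2.symm

theorem orOut_nonempty {Γ : Set (Formula P I)} {φ : Formula P I}
    (hφ : ¬ AutoChecked Γ φ) : (orOut Γ φ).Nonempty := by
  rcases φ with _ | _ | (_ | _ | ψ | ⟨ψ, χ⟩ | ⟨i, ψ⟩ | ⟨i, ψ⟩) | ⟨ψ, χ⟩ | ⟨i, ψ⟩ | ⟨i, ψ⟩ <;>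
    first
      | exact absurd trivial hφ
      | exact Set.singleton_nonempty _
      | exact Set.insert_nonempty _ _

/-- Subformulas of a formula, together with `Kᵢψ` for each subformula `Khᵢψ`. -/
def components : Formula P I → Set (Formula P I)
  | .bot => {Formula.bot}
  | .atom p => {Formula.atom p}
  | .neg φ => insert (Formula.neg φ) (components φ)
  | .and φ ψ => insert (Formula.and φ ψ) (components φ ∪ components ψ)
  | .know i φ => insert (Formula.know i φ) (components φ)
  | .kh i φ => insert (Formula.kh i φ) (insert (Formula.know i φ) (components φ))

theorem finite_components (φ : Formula P I) : (components φ).Finite := by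
  induction φ with
  | bot => exact Set.finite_singleton _
  | atom p => exact Set.finite_singleton _
  | neg φ ih => exact ih.insert _
  | and φ ψ ih1 ih2 => exact (ih1.union ih2).insert _
  | know i φ ih => exact ih.insert _
  | kh i φ ih => exact (ih.insert _).insert _

theorem self_mem_components (φ : Formula P I) : φ ∈ components φ := by
  cases φ <;> simp [components]

theorem components_subset {φ ψ : Formula P I} (h : ψ ∈ components φ) :
    components ψ ⊆ components φ := by
  induction φ with
  | bot => simp only [components, Set.mem_singleton_iff] at h; subst h; rfl
  | atom p => simp only [components, Set.mem_singleton_iff] at h; subst h; rfl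
  | neg φ ih =>
    rcases h with rfl | h
    · rfl
    · exact (ih h).trans (Set.subset_insert _ _)
  | and φ χ ih1 ih2 =>
    rcases h with rfl | h | h
    · rfl
    · exact (ih1 h).trans (Set.subset_union_left.trans (Set.subset_insert _ _))
    · exact (ih2 h).trans (Set.subset_union_right.trans (Set.subset_insert _ _))
  | know i φ ih =>
    rcases h with rfl | h
    · rfl
    · exact (ih h).trans (Set.subset_insert _ _)
  | kh i φ ih =>
    rcases h with rfl | rfl | h
    · rfl
    · exact Set.subset_insert _ _
    · exact (ih h).trans ((Set.subset_insert _ _).trans (Set.subset_insert _ _))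

/-- The components of a formula and their negations. -/
def closure (φ : Formula P I) : Set (Formula P I) :=
  components φ ∪ Set.image Formula.neg (components φ)

theorem finite_closure (φ : Formula P I) : (closure φ).Finite :=
  (finite_components φ).union ((finite_components φ).image _)

theorem ruleClosed_closure (φ : Formula P I) : RuleClosed (closure φ) := by
  have trans : ∀ {ψ χ : Formula P I}, ψ ∈ components φ → χ ∈ components ψ → χ ∈ components φ :=
    fun h h' => components_subset h h'
  have hneg : ∀ {ψ : Formula P I}, Formula.neg ψ ∈ closure φ → ψ ∈ components φ := by
    rintro ψ (h | ⟨χ, h, hχ⟩)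
    · exact trans h (Or.inr (self_mem_components ψ))
    · cases hχ; exact h
  have hpos : ∀ {ψ : Formula P I}, ψ ∈ closure φ → (∀ χ, ψ ≠ Formula.neg χ) →
      ψ ∈ components φ := by
    rintro ψ (h | ⟨χ, h, hχ⟩) hψ
    · exact h
    · exact absurd hχ.symm (hψ χ)
  have both : ∀ {ψ : Formula P I}, ψ ∈ components φ → ψ ∈ closure φ ∧ Formula.neg ψ ∈ closure φ :=
    fun {ψ} h => ⟨Or.inl h, Or.inr ⟨ψ, h, rfl⟩⟩
  have hl : ∀ {ψ χ : Formula P I}, Formula.and ψ χ ∈ components φ → ψ ∈ components φ :=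
    fun {ψ _} h => trans h (Or.inr (Or.inl (self_mem_components ψ)))
  have hr : ∀ {ψ χ : Formula P I}, Formula.and ψ χ ∈ components φ → χ ∈ components φ :=
    fun {_ χ} h => trans h (Or.inr (Or.inr (self_mem_components χ)))
  have hk : ∀ {i} {ψ : Formula P I}, Formula.know i ψ ∈ components φ → ψ ∈ components φ :=
    fun {_ ψ} h => trans h (Or.inr (self_mem_components ψ))
  have hkh : ∀ {i} {ψ : Formula P I}, Formula.kh i ψ ∈ components φ →
      Formula.know i ψ ∈ components φ :=
    fun {_ _} h => trans h (Or.inr (Or.inl rfl))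
  exact
    { neg_neg := fun ψ h => (both (trans (hneg h) (Or.inr (self_mem_components ψ)))).1
      and := fun ψ χ h =>
        have h' := hpos h (by simp)
        ⟨(both (hl h')).1, (both (hr h')).1⟩
      neg_and := fun ψ χ h => ⟨both (hl (hneg h)), both (hr (hneg h))⟩
      know := fun i ψ h => (both (hk (hpos h (by simp)))).1
      neg_know := fun i ψ h => both (hk (hneg h))
      kh := fun i ψ h => both (hkh (hpos h (by simp)))
      neg_kh := fun i ψ h => (both (hkh (hneg h))).2 }

/-- Strip all leading negations. -/
def core : Formula P I → Formula P I
  | .neg φ => core φ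
  | φ => φ

/-- The formulas decided by `Γ`, up to leading negations. -/
def decided (Γ : Set (Formula P I)) : Set (Formula P I) :=
  {φ | core φ ∈ Γ ∨ Formula.neg (core φ) ∈ Γ}

theorem Saturated.subset_decided {Γ : Set (Formula P I)} (hΓ : Saturated Γ) : Γ ⊆ decided Γ := by
  have key : ∀ φ, (φ ∈ Γ → φ ∈ decided Γ) ∧ (Formula.neg φ ∈ Γ → φ ∈ decided Γ) := by
    intro φ
    induction φ with
    | neg φ ih => exact ⟨ih.2, fun h => ih.1 (hΓ _ h)⟩
    | _ => exact ⟨Or.inl, Or.inr⟩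
  exact fun φ => (key φ).1

theorem Saturated.ruleClosed_decided {Γ : Set (Formula P I)} (hΓ : Saturated Γ) :
    RuleClosed (decided Γ) := by
  have sub := hΓ.subset_decided
  have hn : ∀ {φ : Formula P I}, Formula.neg φ ∈ Γ → φ ∈ decided Γ :=
    fun {φ} h => show Formula.neg φ ∈ decided Γ from sub h
  have hand : ∀ {ψ χ : Formula P I}, Formula.and ψ χ ∈ decided Γ →
      ψ ∈ decided Γ ∧ χ ∈ decided Γ := by
    rintro ψ χ (h | h)
    · exact ⟨sub (hΓ _ h).1, sub (hΓ _ h).2⟩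
    · rcases hΓ _ h with h | h | h
      · exact ⟨hn h.1, hn h.2⟩
      · exact ⟨hn h.1, sub h.2⟩
      · exact ⟨sub h.1, hn h.2⟩
  have hknow : ∀ {i} {ψ : Formula P I}, Formula.know i ψ ∈ decided Γ → ψ ∈ decided Γ := by
    rintro i ψ (h | h)
    · exact sub (hΓ _ h)
    · exact (hΓ _ h).elim hn (fun h => sub h)
  have hkh : ∀ {i} {ψ : Formula P I}, Formula.kh i ψ ∈ decided Γ →
      Formula.know i ψ ∈ decided Γ := by
    rintro i ψ (h | h)
    · exact (hΓ _ h).elim Or.inr Or.inl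
    · exact Or.inr (hΓ _ h)
  exact
    { neg_neg := fun _ h => h
      and := fun _ _ h => hand h
      neg_and := fun _ _ h => ⟨⟨(hand h).1, (hand h).1⟩, (hand h).2, (hand h).2⟩
      know := fun _ _ h => hknow h
      neg_know := fun i ψ h =>
        have h' : ψ ∈ decided Γ := hknow (i := i) h
        ⟨h', h'⟩
      kh := fun _ _ h => ⟨hkh h, hkh h⟩
      neg_kh := fun _ _ h => hkh h }

/-! ### Models built from saturated labels -/

/-- `φ` is of the form `Kᵢχ`, `¬Kᵢχ`, `Khᵢχ` or `¬Khᵢχ`. -/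
def IsAgentFormula (i : I) (φ : Formula P I) : Prop :=
  (∃ χ, φ = Formula.know i χ) ∨ (∃ χ, φ = Formula.neg (Formula.know i χ)) ∨
    (∃ χ, φ = Formula.kh i χ) ∨ (∃ χ, φ = Formula.neg (Formula.kh i χ))

/-- `Γ` and `Δ` contain the same formulas governed by agent `i`. -/
def AgentEquiv (i : I) (Γ Δ : Set (Formula P I)) : Prop :=
  ∀ φ, IsAgentFormula i φ → (φ ∈ Γ ↔ φ ∈ Δ)

theorem AgentEquiv.of_sigmaSet_subset {Γ Δ : Set (Formula P I)} {i : I} {ψ : Formula P I}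
    (hΔ : ¬ Blatant Δ) (hsub : SigmaSet Γ i ψ ⊆ Δ) (hdec : Δ ⊆ decided Γ) :
    AgentEquiv i Γ Δ := by
  intro φ hφ
  have hmem : ∀ χ, IsAgentFormula i χ → χ ∈ Γ → χ ∈ Δ := fun χ hχ h => hsub (Or.inr ⟨h, hχ⟩)
  refine ⟨hmem φ hφ, fun h => ?_⟩
  have hd := hdec h
  rcases hφ with ⟨χ, rfl⟩ | ⟨χ, rfl⟩ | ⟨χ, rfl⟩ | ⟨χ, rfl⟩
  · exact hd.resolve_right fun h' =>
      hΔ (Or.inr ⟨_, h, hmem _ (Or.inr (Or.inl ⟨_, rfl⟩)) h'⟩)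
  · exact hd.resolve_left fun h' => hΔ (Or.inr ⟨_, hmem _ (Or.inl ⟨_, rfl⟩) h', h⟩)
  · exact hd.resolve_right fun h' =>
      hΔ (Or.inr ⟨_, h, hmem _ (Or.inr (Or.inr (Or.inr ⟨_, rfl⟩))) h'⟩)
  · exact hd.resolve_left fun h' =>
      hΔ (Or.inr ⟨_, hmem _ (Or.inr (Or.inr (Or.inl ⟨_, rfl⟩))) h', h⟩)

/-- A family of saturated, consistent labels containing the witnesses required by
the formulas `¬Kᵢψ`, `Khᵢψ` and `¬Khᵢχ` occurring in its members. -/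
structure HintikkaFamily (F : Set (Set (Formula P I))) : Prop where
  saturated : ∀ Γ ∈ F, Saturated Γ
  not_blatant : ∀ Γ ∈ F, ¬ Blatant Γ
  neg_know : ∀ Γ ∈ F, ∀ i ψ, Formula.neg (.know i ψ) ∈ Γ →
    ∃ Δ ∈ F, AgentEquiv i Γ Δ ∧ Formula.neg ψ ∈ Δ
  kh : ∀ Γ ∈ F, ∀ i ψ, Formula.kh i ψ ∈ Γ → Formula.neg (.know i ψ) ∈ Γ →
    ∃ Δ ∈ F, Formula.know i ψ ∈ Δ
  neg_kh : ∀ Γ ∈ F, ∀ i ψ χ, Formula.neg (.kh i χ) ∈ Γ → Formula.kh i ψ ∈ Γ →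
    Formula.neg (.know i ψ) ∈ Γ →
    ∃ Δ ∈ F, Formula.know i ψ ∈ Δ ∧ Formula.neg (.kh i χ) ∈ Δ

/-- The model whose states are the labels in `F`; the action `a_{Khᵢψ}` leads from
states where `Khᵢψ` and `¬Kᵢψ` hold to all states where `Kᵢψ` holds. -/
def labelModel (F : Set (Set (Formula P I))) : Model P I where
  W := F
  sim i Γ Δ := AgentEquiv i Γ.1 Δ.1
  equiv _ := ⟨fun _ _ _ => Iff.rfl, fun h φ hφ => (h φ hφ).symm,
    fun h h' φ hφ => (h φ hφ).trans (h' φ hφ)⟩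
  Act _ := Formula P I
  R i ψ Γ Δ := Formula.kh i ψ ∈ Γ.1 ∧ Formula.neg (.know i ψ) ∈ Γ.1 ∧ Formula.know i ψ ∈ Δ.1
  V Γ p := Formula.atom p ∈ Γ.1

namespace HintikkaFamily

variable {F : Set (Set (Formula P I))}

theorem not_both (hF : HintikkaFamily F) (Γ : F) {φ : Formula P I}
    (h : φ ∈ Γ.1) (h' : Formula.neg φ ∈ Γ.1) : False :=
  hF.not_blatant _ Γ.2 (Or.inr ⟨φ, h, h'⟩)

open Classical in
/-- The one-step strategy playing `a_{Khᵢψ}` where `Khᵢψ` and `¬Kᵢψ` hold. -/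
noncomputable def khStrategy (hF : HintikkaFamily F) (i : I) (ψ : Formula P I) :
    Strategy (labelModel F) i where
  act Γ := if Formula.kh i ψ ∈ Γ.1 ∧ Formula.neg (.know i ψ) ∈ Γ.1 then some ψ else none
  congr Γ Δ h := by
    rw [h _ (Or.inr (Or.inr (Or.inl ⟨ψ, rfl⟩))), h _ (Or.inr (Or.inl ⟨ψ, rfl⟩))]
  exec Γ a ha Δ h := by
    split_ifs at ha with hψ
    cases ha
    rw [h _ (Or.inr (Or.inr (Or.inl ⟨ψ, rfl⟩))), h _ (Or.inr (Or.inl ⟨ψ, rfl⟩))] at hψ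
    obtain ⟨Θ, hΘ, hk⟩ := hF.kh _ Δ.2 i ψ hψ.1 hψ.2
    exact ⟨⟨Θ, hΘ⟩, hψ.1, hψ.2, hk⟩

theorem khStrategy_act_eq_none (hF : HintikkaFamily F) {i : I} {ψ : Formula P I}
    {Γ : (labelModel F).W} (h : Formula.know i ψ ∈ Γ.1) : (hF.khStrategy i ψ).act Γ = none :=
  if_neg fun h' => hF.not_both Γ h h'.2

theorem know_mem_of_khStrategy_steps (hF : HintikkaFamily F) {i : I} {ψ : Formula P I}
    {δ : ℕ → (labelModel F).W} {k : ℕ} (h : (hF.khStrategy i ψ).Steps δ k) :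
    Formula.know i ψ ∈ (δ (k + 1)).1 := by
  obtain ⟨a, ha, s, t, -, ht, -, -, hR⟩ := h
  have : ψ = a := by
    by_cases hc : Formula.kh i ψ ∈ (δ k).1 ∧ Formula.neg (.know i ψ) ∈ (δ k).1
    · exact Option.some.inj ((if_pos hc).symm.trans ha)
    · exact absurd ((if_neg hc).symm.trans ha) (by simp)
  subst this
  exact (ht _ (Or.inl ⟨_, rfl⟩)).2 hR

theorem know_mem_of_completeFinExec (hF : HintikkaFamily F) {i : I} {ψ : Formula P I}
    {δ : ℕ → (labelModel F).W} {h : ℕ} (h0 : Formula.kh i ψ ∈ (δ 0).1)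
    (hδ : (hF.khStrategy i ψ).CompleteFinExec δ h) : Formula.know i ψ ∈ (δ h).1 := by
  cases h with
  | zero =>
    rcases hF.saturated _ (δ 0).2 _ h0 with h' | h'
    · exact absurd ((if_pos ⟨h0, h'⟩).symm.trans hδ.2) (by simp)
    · exact h'
  | succ k => exact hF.know_mem_of_khStrategy_steps (hδ.1 k k.lt_succ_self)

/-- A strategy for `i` started where `¬Khᵢχ` holds either runs forever or has a
complete execution ending where `¬Khᵢχ` still holds. -/
theorem exists_exec_neg_kh (hF : HintikkaFamily F) {i : I} {χ : Formula P I}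
    (σ : Strategy (labelModel F) i) (Γ : (labelModel F).W) (hΓ : Formula.neg (.kh i χ) ∈ Γ.1) :
    ∃ δ : ℕ → (labelModel F).W, δ 0 = Γ ∧
      (σ.InfExec δ ∨ ∃ h, σ.CompleteFinExec δ h ∧ Formula.neg (.kh i χ) ∈ (δ h).1) := by
  have step : ∀ Δ : {Δ : (labelModel F).W // Formula.neg (.kh i χ) ∈ Δ.1},
      ∃ Θ : {Δ : (labelModel F).W // Formula.neg (.kh i χ) ∈ Δ.1},
        ∀ a, σ.act Δ.1 = some a → (labelModel F).ctrans i a Δ.1 Θ.1 := by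
    rintro ⟨Δ, hΔ⟩
    rcases hact : σ.act Δ with _ | a
    · exact ⟨⟨Δ, hΔ⟩, fun a h => absurd h (by simp)⟩
    · obtain ⟨u, hkh, hnk, -⟩ := σ.exec Δ a hact Δ (((labelModel F).equiv i).refl Δ)
      obtain ⟨Θ, hΘ, hk, hn⟩ := hF.neg_kh _ Δ.2 i a χ hΔ hkh hnk
      refine ⟨⟨⟨Θ, hΘ⟩, hn⟩, fun b hb => ?_⟩
      cases hb
      exact ⟨Δ, ⟨Θ, hΘ⟩, ((labelModel F).equiv i).refl _, ((labelModel F).equiv i).refl _,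
        hkh, hnk, hk⟩
  choose next hnext using step
  let δ : ℕ → {Δ : (labelModel F).W // Formula.neg (.kh i χ) ∈ Δ.1} :=
    fun k => next^[k] ⟨Γ, hΓ⟩
  have hδ : ∀ k a, σ.act (δ k).1 = some a →
      (labelModel F).ctrans i a (δ k).1 (δ (k + 1)).1 := by
    intro k a ha
    simp only [δ, Function.iterate_succ_apply']
    exact hnext _ a ha
  refine ⟨fun k => (δ k).1, rfl, ?_⟩
  by_cases hex : ∃ k, σ.act (δ k).1 = none
  · classical
    refine Or.inr ⟨Nat.find hex, ⟨fun k hk => ?_, Nat.find_spec hex⟩, (δ _).2⟩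
    obtain ⟨a, ha⟩ := Option.ne_none_iff_exists'.1 (Nat.find_min hex hk)
    exact ⟨a, ha, hδ k a ha⟩
  · refine Or.inl fun k => ?_
    obtain ⟨a, ha⟩ := Option.ne_none_iff_exists'.1 fun h => hex ⟨k, h⟩
    exact ⟨a, ha, hδ k a ha⟩

theorem truth (hF : HintikkaFamily F) (φ : Formula P I) (Γ : (labelModel F).W) :
    (φ ∈ Γ.1 → Sat (labelModel F) Γ φ) ∧
      (Formula.neg φ ∈ Γ.1 → ¬ Sat (labelModel F) Γ φ) := by
  induction φ generalizing Γ with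
  | bot => exact ⟨fun h => hF.not_blatant _ Γ.2 (Or.inl h), fun _ h => h⟩
  | atom p => exact ⟨fun h => h, fun h h' => hF.not_both Γ h' h⟩
  | neg φ ih =>
    exact ⟨(ih Γ).2, fun h h' => h' ((ih Γ).1 (hF.saturated _ Γ.2 _ h))⟩
  | and φ ψ ih1 ih2 =>
    refine ⟨fun h => ⟨(ih1 Γ).1 (hF.saturated _ Γ.2 _ h).1,
      (ih2 Γ).1 (hF.saturated _ Γ.2 _ h).2⟩, fun h hs => ?_⟩
    rcases hF.saturated _ Γ.2 _ h with h | h | h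
    · exact (ih1 Γ).2 h.1 hs.1
    · exact (ih1 Γ).2 h.1 hs.1
    · exact (ih2 Γ).2 h.2 hs.2
  | know i ψ ih =>
    refine ⟨fun h Δ hΔ => (ih Δ).1 (hF.saturated _ Δ.2 _ ((hΔ _ (Or.inl ⟨ψ, rfl⟩)).1 h)),
      fun h hs => ?_⟩
    obtain ⟨Δ, hΔ, hsim, hn⟩ := hF.neg_know _ Γ.2 i ψ h
    exact (ih ⟨Δ, hΔ⟩).2 hn (hs ⟨Δ, hΔ⟩ hsim)
  | kh i ψ ih =>
    constructor
    · intro h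
      refine ⟨hF.khStrategy i ψ, fun δ _ hinf => ?_, fun δ k h0 hδ t ht => ?_⟩
      · obtain ⟨a, ha, -⟩ := hinf 1
        rw [hF.khStrategy_act_eq_none (hF.know_mem_of_khStrategy_steps (hinf 0))] at ha
        cases ha
      · have hk := hF.know_mem_of_completeFinExec
          ((h0 _ (Or.inr (Or.inr (Or.inl ⟨ψ, rfl⟩)))).1 h) hδ
        exact (ih t).1 (hF.saturated _ t.2 _ ((ht _ (Or.inl ⟨ψ, rfl⟩)).1 hk))
    · rintro h ⟨σ, hfin, hend⟩
      obtain ⟨δ, rfl, hinf | ⟨k, hδ, hk⟩⟩ := hF.exists_exec_neg_kh σ Γ h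
      · exact hfin δ (((labelModel F).equiv i).refl _) hinf
      · obtain ⟨Δ, hΔ, hsim, hn⟩ := hF.neg_know _ (δ k).2 i ψ (hF.saturated _ (δ k).2 _ hk)
        exact (ih ⟨Δ, hΔ⟩).2 hn
          (hend δ k (((labelModel F).equiv i).refl _) hδ ⟨Δ, hΔ⟩ hsim)

end HintikkaFamily

/-! ### Labels of an open complete subtree -/

namespace IsTableau

variable {T} {φ0 : Formula P I} {S : Set T.Node}

theorem blockedBy_eq_none_of_child (hT : IsTableau φ0 T) {m n : T.Node}
    (h : T.parent m = some n) : T.blockedBy n = none := by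
  by_contra hb
  exact hT.blocked_leaf n hb m h

theorem label_subset_closure (hT : IsTableau φ0 T) (n : T.Node) : T.label n ⊆ closure φ0 := by
  have hC := ruleClosed_closure φ0
  induction hd : T.depth n generalizing n with
  | zero =>
    rcases hp : T.parent n with _ | m
    · rw [T.eq_root n hp, hT.root_label, Set.singleton_subset_iff]
      exact Or.inl (self_mem_components φ0)
    · have := T.depth_parent n m hp
      omega
  | succ d ih =>
    rcases hp : T.parent n with _ | m
    · have := T.depth_root
      rw [T.eq_root n hp] at hd
      omega
    have hm : T.label m ⊆ closure φ0 := ih m (by have := T.depth_parent n m hp; omega)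
    have hnb : ¬ Blatant (T.label m) := fun hb => hT.blatant_leaf m hb n hp
    have hbl := hT.blockedBy_eq_none_of_child hp
    by_cases hs : Saturated (T.label m)
    · rcases (hT.and_node m hnb hbl hs).2.2.2 n hp with
        ⟨i, ψ, -, hψ, hl, -⟩ | ⟨i, ψ, -, hψ, -, hl⟩ | ⟨i, ψ, χ, -, hχ, hψ, -, hl⟩ <;> rw [hl]
      · exact Set.insert_subset (hC.neg_know _ _ (hm hψ)).2 fun _ h => hm h.1
      · exact Set.singleton_subset_iff.2 (hC.kh _ _ (hm hψ)).1
      · exact Set.insert_subset (hC.kh _ _ (hm hψ)).1 (Set.singleton_subset_iff.2 (hm hχ))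
    · obtain ⟨φ, hφ, -, -, hch⟩ := hT.or_node m hnb hbl hs
      exact hC.orOut_subset hm hφ (hch n hp).2.1

/-- From an unblocked node of an open complete subtree one can descend along `ε`-edges
to a saturated node, staying within any rule-closed set. -/
theorem exists_saturated (hT : IsTableau φ0 T) (hS : CompleteSubtree T S)
    (hopen : ¬ ClosedSubtree T S) {D : Set (Formula P I)} (hD : RuleClosed D) (n : T.Node)
    (hn : n ∈ S) (hb : T.blockedBy n = none) (hnD : T.label n ⊆ D) :
    ∃ m ∈ S, T.blockedBy m = none ∧ Saturated (T.label m) ∧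
      T.label n ⊆ T.label m ∧ T.label m ⊆ D := by
  induction hc : (closure φ0 \ T.label n).ncard using Nat.strong_induction_on
    generalizing n with
  | _ c ih =>
    by_cases hs : Saturated (T.label n)
    · exact ⟨n, hn, hb, hs, subset_rfl, hnD⟩
    obtain ⟨φ, hφ, hunch, hex, hch⟩ := hT.or_node n (fun h => hopen ⟨n, hn, h⟩) hb hs
    have hleaf : ¬ IsLeaf T n := fun hl => by
      obtain ⟨Δ, hΔ⟩ := orOut_nonempty hunch
      obtain ⟨m, hm, -⟩ := hex Δ hΔ
      exact hl m hm
    obtain ⟨m, hmn, hm⟩ := hS.2.2 n hn hleaf hs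
    obtain ⟨-, hout, hbm⟩ := hch m hmn
    have hss := ssubset_of_mem_orOut hunch hout
    have hlt : (closure φ0 \ T.label m).ncard < c := by
      rw [← hc]
      obtain ⟨θ, hθ, hθ'⟩ := Set.exists_of_ssubset hss
      refine Set.ncard_lt_ncard ⟨Set.sdiff_subset_sdiff_right hss.1, fun h => ?_⟩
        (finite_closure φ0).sdiff
      exact (h ⟨hT.label_subset_closure m hθ, hθ'⟩).2 hθ
    obtain ⟨k, hk, hbk, hsk, hsub, hkD⟩ :=
      ih _ hlt m hm hbm (hD.orOut_subset hnD hφ hout) rfl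
    exact ⟨k, hk, hbk, hsk, hss.1.trans hsub, hkD⟩

theorem ancestor_mem (hS : IsSubtree T S) {m n : T.Node} (h : Ancestor T m n) (hn : n ∈ S) :
    m ∈ S := by
  induction h with
  | single h => exact hS.2 _ hn _ h
  | tail _ h ih => exact ih (hS.2 _ hn _ h)

theorem ancestor_of_iAnc {i : I} {m n : T.Node} (h : IAnc T i m n) : Ancestor T m n := by
  induction h with
  | single h => exact .single h
  | cons h _ _ ih => exact .tail ih h

theorem blockedBy_eq_none_of_ancestor (hT : IsTableau φ0 T) {m n : T.Node}
    (h : Ancestor T m n) : T.blockedBy m = none := by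
  obtain ⟨k, hk, -⟩ := Relation.TransGen.head'_iff.1 h
  exact hT.blockedBy_eq_none_of_child hk

/-- The labels of the unblocked saturated nodes of `S`. -/
def saturatedLabels (S : Set T.Node) : Set (Set (Formula P I)) :=
  {Γ | ∃ n ∈ S, T.blockedBy n = none ∧ Saturated (T.label n) ∧ T.label n = Γ}

theorem hintikkaFamily (hT : IsTableau φ0 T) (hS : CompleteSubtree T S)
    (hopen : ¬ ClosedSubtree T S) : HintikkaFamily (saturatedLabels S) := by
  have hnb : ∀ n ∈ S, ¬ Blatant (T.label n) := fun n hn h => hopen ⟨n, hn, h⟩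
  have child : ∀ n ∈ S, Saturated (T.label n) → ∀ m, T.parent m = some n → m ∈ S :=
    fun n hn hs m hm => hS.2.1 n hn (fun hl => hl m hm) hs m hm
  have hC := ruleClosed_closure φ0
  refine ⟨?_, ?_, ?_, ?_, ?_⟩
  · rintro _ ⟨n, hn, hb, hs, rfl⟩
    exact hs
  · rintro _ ⟨n, hn, hb, hs, rfl⟩
    exact hnb n hn
  · rintro _ ⟨n, hn, hb, hs, rfl⟩ i ψ hψ
    obtain ⟨m, hm, hbm, hl⟩ : ∃ m ∈ S, T.blockedBy m = none ∧
        T.label m = SigmaSet (T.label n) i ψ := by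
      by_cases hex : ∃ n', IAnc T i n' n ∧ T.label n' = SigmaSet (T.label n) i ψ
      · obtain ⟨n', ha, hl⟩ := hex
        have ha := ancestor_of_iAnc ha
        exact ⟨n', ancestor_mem hS.1 ha hn, hT.blockedBy_eq_none_of_ancestor ha, hl⟩
      · obtain ⟨m, hp, -, hl, hbm⟩ := (hT.and_node n (hnb n hn) hb hs).1 i ψ hψ hex
        exact ⟨m, child n hn hs m hp, hbm, hl⟩
    have hD := hs.ruleClosed_decided
    have hmD : T.label m ⊆ decided (T.label n) := by
      rw [hl]
      exact Set.insert_subset (hD.neg_know _ _ (hs.subset_decided hψ)).2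
        fun _ h => hs.subset_decided h.1
    obtain ⟨k, hk, hbk, hsk, hsub, hkD⟩ := hT.exists_saturated hS hopen hD m hm hbm hmD
    rw [hl] at hsub
    exact ⟨_, ⟨k, hk, hbk, hsk, rfl⟩, .of_sigmaSet_subset (hnb k hk) hsub hkD,
      hsub (Set.mem_insert _ _)⟩
  · rintro _ ⟨n, hn, hb, hs, rfl⟩ i ψ hψ hnk
    obtain ⟨m, hp, -, hl, hbm⟩ := (hT.and_node n (hnb n hn) hb hs).2.1 i ψ hψ hnk
    obtain ⟨k, hk, hbk, hsk, hsub, -⟩ := hT.exists_saturated hS hopen hC m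
      (child n hn hs m hp) hbm (hT.label_subset_closure m)
    exact ⟨_, ⟨k, hk, hbk, hsk, rfl⟩, hsub (by rw [hl]; exact rfl)⟩
  · rintro _ ⟨n, hn, hb, hs, rfl⟩ i ψ χ hχ hψ hnk
    obtain ⟨m, hp, -, hl, -⟩ := (hT.and_node n (hnb n hn) hb hs).2.2.1 i ψ χ hχ hψ hnk
    have hm := child n hn hs m hp
    obtain ⟨m', hm', hbm', hl'⟩ : ∃ m' ∈ S, T.blockedBy m' = none ∧ T.label m' = T.label m := by
      rcases hbm : T.blockedBy m with _ | n'
      · exact ⟨m, hm, hbm, rfl⟩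
      · obtain ⟨ha, hl'⟩ := hT.blocked_spec m n' hbm
        exact ⟨n', ancestor_mem hS.1 ha hm, hT.blockedBy_eq_none_of_ancestor ha, hl'⟩
    obtain ⟨k, hk, hbk, hsk, hsub, -⟩ := hT.exists_saturated hS hopen hC m' hm' hbm'
      (hT.label_subset_closure m')
    rw [hl', hl] at hsub
    exact ⟨_, ⟨k, hk, hbk, hsk, rfl⟩, hsub (Or.inl rfl), hsub (Or.inr rfl)⟩

end IsTableau

/-- Completeness: if the tableau for `φ₀` is not closed, then
`φ₀` is satisfiable. -/
theorem tableau_completeness {P I : Type} (hI : ∃ i j : I, i ≠ j)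
    (φ0 : Formula P I) (T : LTree P I) (hT : IsTableau φ0 T)
    (hnc : ¬ TableauClosed T) :
    ∃ (M : Model P I) (s : M.W), Sat M s φ0 := by
  simp only [TableauClosed, not_forall] at hnc
  obtain ⟨S, hS, hopen⟩ := hnc
  have hroot : T.blockedBy T.root = none := by
    rcases hb : T.blockedBy T.root with _ | n
    · rfl
    · obtain ⟨k, -, hk⟩ := Relation.TransGen.tail'_iff.1 (hT.blocked_spec _ n hb).1
      simp [T.parent_root] at hk
  obtain ⟨m, hm, hbm, hsm, hsub, -⟩ := hT.exists_saturated hS hopen (ruleClosed_closure φ0)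
    T.root hS.1.1 hroot (hT.label_subset_closure _)
  have hF := hT.hintikkaFamily hS hopen
  refine ⟨labelModel (IsTableau.saturatedLabels S), ⟨T.label m, m, hm, hbm, hsm, rfl⟩, ?_⟩
  exact (hF.truth φ0 _).1 (hsub (by rw [hT.root_label]; exact rfl))

end ELKh
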